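/- Let G and H be finitely generated groups with finite symmetric generating sets and growth functions gr_G, gr_H. Suppose G and H are integrably measure equivalent: there exist a nonzero σ-finite measure space (Ω,m), commuting m-preserving measurable actions of G and H on Ω which are essentially free, finite-measure measurable fundamental domains Y ⊆ Ω for the G-action and X ⊆ Ω for the H-action, and measurable cocycles α : G × X → H and β : H × Y → G determined by g·x ∈ α(g,x)⁻¹·X for a.e. x ∈ X and h·y ∈ β(h,y)⁻¹·Y for a.e. y ∈ Y, such that ∫_X |α(g,x)|_H dm(x) < ∞ for all g ∈ G and ∫_Y |β(h,y)|_G dm(y) < ∞ for all h ∈ H. Then gr_G ≈ gr_H: there exist constants C₁, C₂ > 0 with gr_G(n) ≤ C₁·gr_H(C₂·n) and gr_H(n) ≤ C₁·gr_G(C₂·n) for all sufficiently large n. -/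

import Mathlib

open MeasureTheory

/-- Word length of `g` with respect to a generating set `S`:
the least `n` such that `g` is a product of `n` elements of `S`. -/
noncomputable def wlen {G : Type*} [Group G] (S : Set G) (g : G) : ℕ :=
  sInf {n : ℕ | ∃ l : List G, (∀ s ∈ l, s ∈ S) ∧ l.length = n ∧ l.prod = g}

open scoped ENNReal

section WordLength

variable {G : Type*} [Group G] {S : Set G}

theorem exists_list_length_eq_wlen (hsymm : ∀ s ∈ S, s⁻¹ ∈ S)
    (hgen : Subgroup.closure S = ⊤) (g : G) :
    ∃ l : List G, (∀ s ∈ l, s ∈ S) ∧ l.length = wlen S g ∧ l.prod = g := by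
  have hg : g ∈ Submonoid.closure (S ∪ S⁻¹) := by
    rw [← Subgroup.closure_toSubmonoid, hgen]
    trivial
  obtain ⟨l, hl, hprod⟩ := Submonoid.exists_list_of_mem_closure hg
  refine Nat.sInf_mem (s := {n : ℕ | ∃ l : List G, (∀ s ∈ l, s ∈ S) ∧ l.length = n ∧ l.prod = g})
    ⟨l.length, l, fun s hs => ?_, rfl, hprod⟩
  rcases hl s hs with h | h
  · exact h
  · simpa using hsymm _ h

theorem wlen_prod_le {l : List G} (hl : ∀ s ∈ l, s ∈ S) : wlen S l.prod ≤ l.length :=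
  Nat.sInf_le ⟨l, hl, rfl, rfl⟩

theorem wlen_one : wlen S (1 : G) = 0 :=
  Nat.le_zero.mp (wlen_prod_le (S := S) (l := []) (by simp))

theorem wlen_mul_le (hsymm : ∀ s ∈ S, s⁻¹ ∈ S) (hgen : Subgroup.closure S = ⊤) (g g' : G) :
    wlen S (g * g') ≤ wlen S g + wlen S g' := by
  obtain ⟨l, hl, hlen, rfl⟩ := exists_list_length_eq_wlen hsymm hgen g
  obtain ⟨l', hl', hlen', rfl⟩ := exists_list_length_eq_wlen hsymm hgen g'
  rw [← hlen, ← hlen', ← List.prod_append, ← List.length_append]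
  refine wlen_prod_le fun s hs => ?_
  rcases List.mem_append.mp hs with h | h
  exacts [hl s h, hl' s h]

theorem finite_wlen_le (hfin : S.Finite) (hsymm : ∀ s ∈ S, s⁻¹ ∈ S)
    (hgen : Subgroup.closure S = ⊤) (n : ℕ) : {g : G | wlen S g ≤ n}.Finite := by
  have : Finite S := hfin
  refine ((List.finite_length_le S n).image fun l => (l.map Subtype.val).prod).subset fun g hg => ?_
  obtain ⟨l, hl, hlen, hprod⟩ := exists_list_length_eq_wlen hsymm hgen g
  lift l to List S using hl
  refine ⟨l, ?_, hprod⟩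
  simpa [← hlen] using hg

theorem finite_wlen_le_real (hfin : S.Finite) (hsymm : ∀ s ∈ S, s⁻¹ ∈ S)
    (hgen : Subgroup.closure S = ⊤) (r : ℝ) : {g : G | (wlen S g : ℝ) ≤ r}.Finite :=
  (finite_wlen_le hfin hsymm hgen ⌊r⌋₊).subset fun _ hg => Nat.le_floor hg

end WordLength

section OrbitSum

variable {Γ Ω : Type*} [Group Γ] [MulAction Γ Ω]

/-- The sum of `f` over those points of the `Γ`-orbit of `ω` which lie in `X`,
counted with multiplicity. -/
noncomputable def orbitSum (Γ : Type*) {Ω : Type*} [Group Γ] [MulAction Γ Ω]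
    (X : Set Ω) (f : Ω → ℝ≥0∞) (ω : Ω) : ℝ≥0∞ :=
  ∑' γ : Γ, X.indicator f (γ • ω)

theorem orbitSum_smul (X : Set Ω) (f : Ω → ℝ≥0∞) (γ : Γ) (ω : Ω) :
    orbitSum Γ X f (γ • ω) = orbitSum Γ X f ω := by
  simp only [orbitSum, smul_smul]
  exact (Equiv.mulRight γ).tsum_eq fun δ => X.indicator f (δ • ω)

theorem orbitSum_eq_of_existsUnique {X : Set Ω} {ω : Ω} (h : ∃! γ : Γ, γ • ω ∈ X)
    {γ : Γ} (hγ : γ • ω ∈ X) (f : Ω → ℝ≥0∞) : orbitSum Γ X f ω = f (γ • ω) := by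
  rw [orbitSum, tsum_eq_single γ, Set.indicator_of_mem hγ]
  intro δ hδ
  exact Set.indicator_of_notMem (fun h' => hδ (h.unique h' hγ)) f

theorem one_le_orbitSum_one {X : Set Ω} {ω : Ω} (hω : ω ∈ X) : 1 ≤ orbitSum Γ X 1 ω := by
  refine le_trans ?_ (ENNReal.le_tsum (1 : Γ))
  simp [hω]

/-- The weight of a point of `X`, chosen such that the total weight of an orbit is at most one. -/
noncomputable def orbitWeight (Γ : Type*) {Ω : Type*} [Group Γ] [MulAction Γ Ω]
    (X : Set Ω) (ω : Ω) : ℝ≥0∞ :=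
  (orbitSum Γ X 1 ω)⁻¹

theorem orbitWeight_le_one {X : Set Ω} {ω : Ω} (hω : ω ∈ X) : orbitWeight Γ X ω ≤ 1 :=
  ENNReal.inv_le_one.mpr (one_le_orbitSum_one hω)

theorem tsum_orbitWeight_le_one (X : Set Ω) (ω : Ω) :
    ∑' γ : Γ, X.indicator (orbitWeight Γ X) (γ • ω) ≤ 1 := by
  have h (γ : Γ) : X.indicator (orbitWeight Γ X) (γ • ω) =
      X.indicator 1 (γ • ω) * (orbitSum Γ X 1 ω)⁻¹ := by
    by_cases hγ : γ • ω ∈ X <;> simp [hγ, orbitWeight, orbitSum_smul]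
  simp_rw [h, ENNReal.tsum_mul_right]
  exact ENNReal.mul_inv_le_one _

variable [MeasurableSpace Ω] [MeasurableConstSMul Γ Ω] {m : Measure Ω}

theorem isFundamentalDomain_of_ae_existsUnique [SMulInvariantMeasure Γ Ω m] {X : Set Ω}
    (hX : MeasurableSet X) (h : ∀ᵐ ω ∂m, ∃! γ : Γ, γ • ω ∈ X) : IsFundamentalDomain Γ X m := by
  refine .mk'' hX.nullMeasurableSet (h.mono fun ω hω => hω.exists) (fun γ hγ => ?_)
    fun γ => (measurePreserving_smul γ m).quasiMeasurePreserving
  refine measure_eq_zero_iff_ae_notMem.mpr (h.mono fun ω hω hmem => hγ ?_)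
  have h1 : γ⁻¹ • ω ∈ X := Set.mem_smul_set_iff_inv_smul_mem.mp hmem.1
  have h2 : (1 : Γ) • ω ∈ X := by simpa using hmem.2
  simpa using hω.unique h1 h2

variable [Countable Γ]

theorem measurable_orbitSum {X : Set Ω} (hX : MeasurableSet X) {f : Ω → ℝ≥0∞} (hf : Measurable f) :
    Measurable (orbitSum Γ X f) :=
  Measurable.tsum fun γ => (hf.indicator hX).comp (measurable_const_smul γ)

theorem measurable_orbitWeight {X : Set Ω} (hX : MeasurableSet X) :
    Measurable (orbitWeight Γ X) :=
  (measurable_orbitSum hX measurable_one).inv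

variable [SMulInvariantMeasure Γ Ω m]

theorem ae_forall_smul {p : Ω → Prop} (h : ∀ᵐ ω ∂m, p ω) : ∀ᵐ ω ∂m, ∀ γ : Γ, p (γ • ω) :=
  ae_all_iff.mpr fun γ => (measurePreserving_smul γ m).quasiMeasurePreserving.ae h

theorem ae_orbitSum_one_lt_top {X Y : Set Ω} (hX : MeasurableSet X) (hXfin : m X < ⊤)
    (hYm : MeasurableSet Y) (hY : IsFundamentalDomain Γ Y m) :
    ∀ᵐ ω ∂m, orbitSum Γ X 1 ω < ⊤ := by
  have hint : ∫⁻ ω in Y, orbitSum Γ X 1 ω ∂m = m X := by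
    simp only [orbitSum]
    rw [lintegral_tsum, ← hY.lintegral_eq_tsum'', lintegral_indicator_one hX]
    exact fun γ =>
      ((measurable_one.indicator hX).comp (measurable_const_smul γ)).aemeasurable
  have hae := (ae_restrict_iff' hYm).mp
    (ae_lt_top (measurable_orbitSum hX measurable_one) (hint ▸ hXfin.ne))
  filter_upwards [ae_forall_smul (Γ := Γ) hae, hY.ae_covers] with ω h1 ⟨γ, hγ⟩
  simpa [orbitSum_smul] using h1 γ hγ

end OrbitSum

section Coupling

variable {G H Ω : Type*} [Group G] [Group H] [MeasurableSpace Ω] {m : Measure Ω} {X Y : Set Ω}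
  {α : G → Ω → H}

theorem measurable_wlen_cocycle [Countable H] (S : Set H) {a : Ω → H}
    (ha : ∀ h, MeasurableSet {ω | a ω = h}) : Measurable fun ω => (wlen S (a ω) : ℝ≥0∞) := by
  let _ : MeasurableSpace H := ⊤
  have : Measurable a := measurable_to_countable' ha
  exact Measurable.comp (g := fun h => (wlen S h : ℝ≥0∞)) measurable_from_top this

variable [MulAction G Ω] [MulAction H Ω]

theorem lintegral_wlen_cocycle_one {S : Set H} (hXm : MeasurableSet X)
    (hX : ∀ᵐ ω ∂m, ∃! h : H, h • ω ∈ X)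
    (hα : ∀ g : G, ∀ᵐ ω ∂m, ω ∈ X → α g ω • g • ω ∈ X) :
    ∫⁻ ω in X, wlen S (α 1 ω) ∂m = 0 := by
  refine (setLIntegral_congr_fun_ae (g := fun _ => 0) hXm ?_).trans (by simp)
  filter_upwards [hX, hα 1] with ω h1 h2 hω
  have : α 1 ω = 1 := h1.unique (by simpa using h2 hω) (by simpa using hω)
  simp [this, wlen_one]

variable [Countable H] [SMulCommClass G H Ω] [MeasurableConstSMul G Ω] [MeasurableConstSMul H Ω]
  [SMulInvariantMeasure G Ω m] [SMulInvariantMeasure H Ω m]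

open scoped Pointwise in
theorem setLIntegral_comp_smul_of_invariant (hX : IsFundamentalDomain H X m) (g : G)
    {f : Ω → ℝ≥0∞} (hf : ∀ (h : H) ω, f (h • ω) = f ω) :
    ∫⁻ ω in X, f (g • ω) ∂m = ∫⁻ ω in X, f ω ∂m := by
  rw [(measurePreserving_smul g m).setLIntegral_comp_emb (measurableEmbedding_const_smul g)]
  exact (hX.smul_of_comm g).setLIntegral_eq hX f hf

variable [Countable G]

theorem lintegral_wlen_cocycle_mul_le {S : Set H} (hsymm : ∀ s ∈ S, s⁻¹ ∈ S)
    (hgen : Subgroup.closure S = ⊤) (hXm : MeasurableSet X)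
    (hX : ∀ᵐ ω ∂m, ∃! h : H, h • ω ∈ X)
    (hαmeas : ∀ (g : G) (h : H), MeasurableSet {ω | α g ω = h})
    (hα : ∀ g : G, ∀ᵐ ω ∂m, ω ∈ X → α g ω • g • ω ∈ X) (g g' : G) :
    ∫⁻ ω in X, wlen S (α (g * g') ω) ∂m ≤
      ∫⁻ ω in X, wlen S (α g ω) ∂m + ∫⁻ ω in X, wlen S (α g' ω) ∂m := by
  have hfd := isFundamentalDomain_of_ae_existsUnique hXm hX
  set F : Ω → ℝ≥0∞ := orbitSum H X fun ω => wlen S (α g ω) with hF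
  have hFX : ∫⁻ ω in X, F (g' • ω) ∂m = ∫⁻ ω in X, wlen S (α g ω) ∂m := by
    rw [setLIntegral_comp_smul_of_invariant hfd g' (orbitSum_smul X _)]
    refine setLIntegral_congr_fun_ae hXm (hX.mono fun ω hω hωX => ?_)
    simpa using orbitSum_eq_of_existsUnique hω (γ := (1 : H)) (by simpa using hωX)
      fun ω => (wlen S (α g ω) : ℝ≥0∞)
  rw [← hFX, ← lintegral_add_right _ (measurable_wlen_cocycle S (hαmeas g'))]
  refine lintegral_mono_ae ((ae_restrict_iff' hXm).mpr ?_)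
  have hXG := ae_forall_smul (Γ := G) hX
  have hαGH := ae_forall_smul (Γ := G) (ae_forall_smul (Γ := H) (hα g))
  filter_upwards [hXG, hαGH, hα (g * g'), hα g'] with ω h1 h2 h3 h4 hω
  have h5 := h2 g' _ (h4 hω)
  have h6 : (α g (α g' ω • g' • ω) * α g' ω) • (g * g') • ω ∈ X := by
    rw [mul_smul, mul_smul]
    rwa [← smul_comm g (α g' ω)]
  rw [hF, orbitSum_eq_of_existsUnique (h1 g') (h4 hω), (h1 (g * g')).unique (h3 hω) h6]
  exact_mod_cast wlen_mul_le hsymm hgen _ _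

theorem exists_lintegral_wlen_cocycle_le {T : Set G} (hTfin : T.Finite)
    (hTsymm : ∀ s ∈ T, s⁻¹ ∈ T) (hTgen : Subgroup.closure T = ⊤)
    {S : Set H} (hsymm : ∀ s ∈ S, s⁻¹ ∈ S)
    (hgen : Subgroup.closure S = ⊤) (hXm : MeasurableSet X)
    (hX : ∀ᵐ ω ∂m, ∃! h : H, h • ω ∈ X)
    (hαmeas : ∀ (g : G) (h : H), MeasurableSet {ω | α g ω = h})
    (hα : ∀ g : G, ∀ᵐ ω ∂m, ω ∈ X → α g ω • g • ω ∈ X)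
    (hint : ∀ g : G, ∫⁻ ω in X, wlen S (α g ω) ∂m < ⊤) :
    ∃ C : ℝ≥0∞, C < ⊤ ∧ ∀ g, ∫⁻ ω in X, wlen S (α g ω) ∂m ≤ wlen T g * C := by
  refine ⟨∑ s ∈ hTfin.toFinset, ∫⁻ ω in X, wlen S (α s ω) ∂m,
    ENNReal.sum_lt_top.mpr fun s _ => hint s, fun g => ?_⟩
  obtain ⟨l, hl, hlen, rfl⟩ := exists_list_length_eq_wlen hTsymm hTgen g
  rw [← hlen]
  clear hlen
  induction l with
  | nil => simp [lintegral_wlen_cocycle_one hXm hX hα]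
  | cons s l ih =>
    rw [List.prod_cons, List.length_cons]
    refine (lintegral_wlen_cocycle_mul_le hsymm hgen hXm hX hαmeas hα s l.prod).trans ?_
    rw [Nat.cast_add, Nat.cast_one, add_mul, one_mul, add_comm]
    refine add_le_add (ih fun t ht => hl t (List.mem_cons_of_mem s ht)) ?_
    exact Finset.single_le_sum (f := fun s => ∫⁻ ω in X, (wlen S (α s ω) : ℝ≥0∞) ∂m)
      (fun _ _ => zero_le) (hTfin.mem_toFinset.mpr (hl s List.mem_cons_self))

/-- The total weight of the fundamental domain `X` controls the number of group elements `g`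
in a finite set `P`, up to the number of elements of `Q` and the part of the cocycle
which does not take values in `Q`. -/
theorem card_mul_lintegral_weight_le [DecidableEq H] (hXm : MeasurableSet X)
    (hX : ∀ᵐ ω ∂m, ∃! h : H, h • ω ∈ X)
    (hα : ∀ g : G, ∀ᵐ ω ∂m, ω ∈ X → α g ω • g • ω ∈ X) (P : Finset G) (Q : Finset H) :
    P.card * ∫⁻ ω in X, orbitWeight G X ω ∂m ≤
      Q.card * m X + ∑ g ∈ P, ∫⁻ ω in X, (if α g ω ∈ Q then 0 else 1) ∂m := by
  have hfd := isFundamentalDomain_of_ae_existsUnique hXm hX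
  have hw : Measurable (X.indicator (orbitWeight G X)) :=
    (measurable_orbitWeight hXm).indicator hXm
  have hV (g : G) : Measurable fun ω => ∑ h ∈ Q, X.indicator (orbitWeight G X) (h • g • ω) :=
    Finset.measurable_sum _ fun h _ =>
      hw.comp ((measurable_const_smul h).comp (measurable_const_smul g))
  have hstep (g : G) : ∫⁻ ω in X, orbitWeight G X ω ∂m ≤
      ∫⁻ ω in X, ∑ h ∈ Q, X.indicator (orbitWeight G X) (h • g • ω) ∂m +
        ∫⁻ ω in X, (if α g ω ∈ Q then 0 else 1) ∂m := by
    rw [← lintegral_add_left (hV g)]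
    calc ∫⁻ ω in X, orbitWeight G X ω ∂m
        = ∫⁻ ω in X, orbitSum H X (orbitWeight G X) ω ∂m := by
          refine setLIntegral_congr_fun_ae hXm (hX.mono fun ω hω hωX => ?_)
          simpa using (orbitSum_eq_of_existsUnique hω (γ := (1 : H)) (by simpa using hωX)
            (orbitWeight G X)).symm
      _ = ∫⁻ ω in X, orbitSum H X (orbitWeight G X) (g • ω) ∂m :=
          (setLIntegral_comp_smul_of_invariant hfd g (orbitSum_smul X _)).symm
      _ ≤ _ := by
          refine lintegral_mono_ae ((ae_restrict_iff' hXm).mpr ?_)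
          filter_upwards [ae_forall_smul (Γ := G) hX, hα g] with ω h1 h2 hω
          rw [orbitSum_eq_of_existsUnique (h1 g) (h2 hω)]
          split_ifs with hQ
          · rw [add_zero, ← Set.indicator_of_mem (h2 hω) (orbitWeight G X)]
            exact Finset.single_le_sum
              (f := fun h : H => X.indicator (orbitWeight G X) (h • g • ω))
              (fun _ _ => zero_le) hQ
          · exact (orbitWeight_le_one (h2 hω)).trans le_add_self
  have hsum : ∑ g ∈ P, ∫⁻ ω in X, ∑ h ∈ Q, X.indicator (orbitWeight G X) (h • g • ω) ∂m ≤
      Q.card * m X := by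
    rw [← lintegral_finsetSum _ fun g _ => hV g, ← setLIntegral_const]
    refine lintegral_mono fun ω => ?_
    dsimp only
    rw [Finset.sum_comm]
    refine (Finset.sum_le_card_nsmul Q _ 1 fun h _ => ?_).trans (by simp)
    simp_rw [← smul_comm _ h ω]
    exact (ENNReal.sum_le_tsum P).trans (tsum_orbitWeight_le_one X (h • ω))
  calc P.card * ∫⁻ ω in X, orbitWeight G X ω ∂m
      = ∑ g ∈ P, ∫⁻ ω in X, orbitWeight G X ω ∂m := by simp
    _ ≤ _ := Finset.sum_le_sum fun g _ => hstep g
    _ ≤ _ := by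
      rw [Finset.sum_add_distrib]
      exact add_le_add_left hsum _

theorem exists_ncard_wlen_le {T : Set G} (hTfin : T.Finite)
    (hTsymm : ∀ s ∈ T, s⁻¹ ∈ T) (hTgen : Subgroup.closure T = ⊤)
    {S : Set H} (hSfin : S.Finite) (hSsymm : ∀ s ∈ S, s⁻¹ ∈ S)
    (hSgen : Subgroup.closure S = ⊤) (hm : m ≠ 0)
    (hXm : MeasurableSet X) (hYm : MeasurableSet Y) (hXfin : m X < ⊤)
    (hX : ∀ᵐ ω ∂m, ∃! h : H, h • ω ∈ X) (hY : ∀ᵐ ω ∂m, ∃! g : G, g • ω ∈ Y)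
    (hαmeas : ∀ (g : G) (h : H), MeasurableSet {ω | α g ω = h})
    (hα : ∀ g : G, ∀ᵐ ω ∂m, ω ∈ X → α g ω • g • ω ∈ X)
    (hint : ∀ g : G, IntegrableOn (fun ω => (wlen S (α g ω) : ℝ)) X m) :
    ∃ C₁ C₂ : ℝ, 0 < C₁ ∧ 0 < C₂ ∧ ∀ n : ℕ, 1 ≤ n →
      ({g : G | wlen T g ≤ n}.ncard : ℝ) ≤
        C₁ * ({h : H | (wlen S h : ℝ) ≤ C₂ * n}.ncard : ℝ) := by
  classical
  have hfd := isFundamentalDomain_of_ae_existsUnique hXm hX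
  have hX0 : m X ≠ 0 := hfd.measure_ne_zero hm
  obtain ⟨C, hC, hle⟩ := exists_lintegral_wlen_cocycle_le hTfin hTsymm hTgen hSsymm hSgen hXm hX
    hαmeas hα fun g => by simpa using (hint g).lintegral_lt_top
  set c := ∫⁻ ω in X, orbitWeight G X ω ∂m with hc
  have hctop : c ≠ ⊤ := by
    refine (lt_of_le_of_lt ?_ hXfin).ne
    rw [← setLIntegral_one]
    exact setLIntegral_mono measurable_const fun ω hω => orbitWeight_le_one hω
  have hc0 : c ≠ 0 := by
    intro h0
    rw [hc, lintegral_eq_zero_iff (measurable_orbitWeight hXm), Filter.EventuallyEq,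
      ae_restrict_iff' hXm] at h0
    refine hX0 (measure_eq_zero_iff_ae_notMem.mpr ?_)
    filter_upwards [h0, ae_orbitSum_one_lt_top hXm hXfin hYm
      (isFundamentalDomain_of_ae_existsUnique hYm hY)] with ω h1 h2 hω
    exact h2.ne (ENNReal.inv_eq_zero.mp (h1 hω))
  have hcpos : 0 < c.toReal := ENNReal.toReal_pos hc0 hctop
  have hXpos : 0 < (m X).toReal := ENNReal.toReal_pos hX0 hXfin.ne
  have hCnn : 0 ≤ C.toReal := ENNReal.toReal_nonneg
  refine ⟨2 * (m X).toReal / c.toReal, 2 * C.toReal / c.toReal + 1, by positivity, by positivity,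
    fun n hn => ?_⟩
  set D : ℝ := 2 * C.toReal / c.toReal + 1 with hD
  have hDpos : 0 < D := by positivity
  have hnpos : (0 : ℝ) < n := by exact_mod_cast hn
  have hPfin := finite_wlen_le hTfin hTsymm hTgen n
  have hQfin := finite_wlen_le_real hSfin hSsymm hSgen (D * n)
  rw [Set.ncard_eq_toFinset_card _ hPfin, Set.ncard_eq_toFinset_card _ hQfin]
  set P := hPfin.toFinset with hP
  set Q := hQfin.toFinset with hQ
  have hR0 : ENNReal.ofReal (D * n) ≠ 0 := by simpa using mul_pos hDpos hnpos
  have htail (g : G) (hg : g ∈ P) : ∫⁻ ω in X, (if α g ω ∈ Q then 0 else 1) ∂m ≤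
      n * C / ENNReal.ofReal (D * n) := by
    calc ∫⁻ ω in X, (if α g ω ∈ Q then 0 else 1) ∂m
        ≤ ∫⁻ ω in X, wlen S (α g ω) / ENNReal.ofReal (D * n) ∂m := by
          refine lintegral_mono fun ω => ?_
          dsimp only
          split_ifs with hω
          · exact zero_le
          · rw [ENNReal.le_div_iff_mul_le (.inl hR0) (.inl ENNReal.ofReal_ne_top), one_mul]
            refine ENNReal.ofReal_le_of_le_toReal ?_
            have : ¬ (wlen S (α g ω) : ℝ) ≤ D * n := by simpa [hQ] using hω
            simpa using (not_le.mp this).le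
      _ = (∫⁻ ω in X, wlen S (α g ω) ∂m) / ENNReal.ofReal (D * n) := by
          simp_rw [div_eq_mul_inv]
          exact lintegral_mul_const _ (measurable_wlen_cocycle S (hαmeas g))
      _ ≤ _ := by
          gcongr
          refine (hle g).trans ?_
          have : wlen T g ≤ n := by simpa [hP] using hg
          gcongr
  have hmain := (card_mul_lintegral_weight_le hXm hX hα P Q).trans
    (add_le_add_right (Finset.sum_le_card_nsmul P _ _ htail) _)
  rw [← hc, nsmul_eq_mul] at hmain
  have hE : n * C / ENNReal.ofReal (D * n) ≠ ⊤ :=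
    ENNReal.div_ne_top (ENNReal.mul_ne_top (by simp) hC.ne) hR0
  have hreal := ENNReal.toReal_mono (ENNReal.add_ne_top.mpr
    ⟨ENNReal.mul_ne_top (by simp) hXfin.ne, ENNReal.mul_ne_top (by simp) hE⟩) hmain
  rw [ENNReal.toReal_add (ENNReal.mul_ne_top (by simp) hXfin.ne)
    (ENNReal.mul_ne_top (by simp) hE)] at hreal
  simp only [ENNReal.toReal_mul, ENNReal.toReal_div, ENNReal.toReal_natCast,
    ENNReal.toReal_ofReal (mul_pos hDpos hnpos).le] at hreal
  have hhalf : n * C.toReal / (D * n) ≤ c.toReal / 2 := by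
    rw [div_le_iff₀ (mul_pos hDpos hnpos)]
    have : c.toReal / 2 * (D * n) = n * C.toReal + c.toReal / 2 * n := by
      rw [hD]; field_simp
    rw [this]
    exact le_add_of_nonneg_right (by positivity)
  have hlast := mul_le_mul_of_nonneg_left hhalf (Nat.cast_nonneg (α := ℝ) P.card)
  rw [div_mul_eq_mul_div, le_div_iff₀ hcpos]
  linarith

end Coupling

theorem stmt14 {G H : Type*} [Group G] [Group H] [Countable G] [Countable H]
    (SG : Set G) (hSGfin : SG.Finite) (hSGsymm : ∀ s ∈ SG, s⁻¹ ∈ SG)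
    (hSGgen : Subgroup.closure SG = ⊤)
    (SH : Set H) (hSHfin : SH.Finite) (hSHsymm : ∀ s ∈ SH, s⁻¹ ∈ SH)
    (hSHgen : Subgroup.closure SH = ⊤)
    -- the coupling space
    {Ω : Type*} [MeasurableSpace Ω] (m : Measure Ω) [SigmaFinite m] (hm : m ≠ 0)
    -- commuting measure-preserving actions of `G` and `H`
    (A : G → Ω → Ω) (B : H → Ω → Ω)
    (hA1 : ∀ ω, A 1 ω = ω) (hAmul : ∀ g g' ω, A (g * g') ω = A g (A g' ω))
    (hB1 : ∀ ω, B 1 ω = ω) (hBmul : ∀ h h' ω, B (h * h') ω = B h (B h' ω))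
    (hAmeas : ∀ g, Measurable (A g)) (hBmeas : ∀ h, Measurable (B h))
    (hApres : ∀ g, MeasurePreserving (A g) m m)
    (hBpres : ∀ h, MeasurePreserving (B h) m m)
    (hcomm : ∀ g h ω, A g (B h ω) = B h (A g ω))
    -- essential freeness
    (hAfree : ∀ᵐ ω ∂m, ∀ g : G, A g ω = ω → g = 1)
    (hBfree : ∀ᵐ ω ∂m, ∀ h : H, B h ω = ω → h = 1)
    -- finite-measure fundamental domains: `Y` for the `G`-action, `X` for the `H`-action
    (X Y : Set Ω) (hXmeas : MeasurableSet X) (hYmeas : MeasurableSet Y)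
    (hXfin : m X < ⊤) (hYfin : m Y < ⊤)
    (hXfund : ∀ᵐ ω ∂m, ∃! h : H, B h ω ∈ X)
    (hYfund : ∀ᵐ ω ∂m, ∃! g : G, A g ω ∈ Y)
    -- the associated cocycles, determined by `g·x ∈ α(g,x)⁻¹·X` and `h·y ∈ β(h,y)⁻¹·Y`
    (α : G → Ω → H) (hαmeas : ∀ (g : G) (h : H), MeasurableSet {ω | α g ω = h})
    (hαdef : ∀ g : G, ∀ᵐ ω ∂m, ω ∈ X → B (α g ω) (A g ω) ∈ X)
    (β : H → Ω → G) (hβmeas : ∀ (h : H) (g : G), MeasurableSet {ω | β h ω = g})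
    (hβdef : ∀ h : H, ∀ᵐ ω ∂m, ω ∈ Y → A (β h ω) (B h ω) ∈ Y)
    -- integrability of the coupling
    (hαint : ∀ g : G, IntegrableOn (fun ω => (wlen SH (α g ω) : ℝ)) X m)
    (hβint : ∀ h : H, IntegrableOn (fun ω => (wlen SG (β h ω) : ℝ)) Y m) :
    ∃ C₁ C₂ : ℝ, 0 < C₁ ∧ 0 < C₂ ∧ ∃ N : ℕ, ∀ n : ℕ, N ≤ n →
      (({g : G | wlen SG g ≤ n}).ncard : ℝ) ≤
          C₁ * (({h : H | (wlen SH h : ℝ) ≤ C₂ * n}).ncard : ℝ) ∧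
      (({h : H | wlen SH h ≤ n}).ncard : ℝ) ≤
          C₁ * (({g : G | (wlen SG g : ℝ) ≤ C₂ * n}).ncard : ℝ) := by
  let _ : MulAction G Ω := { smul := A, one_smul := hA1, mul_smul := hAmul }
  let _ : MulAction H Ω := { smul := B, one_smul := hB1, mul_smul := hBmul }
  have : SMulCommClass G H Ω := ⟨hcomm⟩
  have : SMulCommClass H G Ω := SMulCommClass.symm G H Ω
  have : MeasurableConstSMul G Ω := ⟨hAmeas⟩
  have : MeasurableConstSMul H Ω := ⟨hBmeas⟩
  have : SMulInvariantMeasure G Ω m :=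
    ⟨fun g _ hs => (hApres g).measure_preimage hs.nullMeasurableSet⟩
  have : SMulInvariantMeasure H Ω m :=
    ⟨fun h _ hs => (hBpres h).measure_preimage hs.nullMeasurableSet⟩
  obtain ⟨C₁, C₂, hC₁, hC₂, hle⟩ := exists_ncard_wlen_le hSGfin hSGsymm hSGgen hSHfin hSHsymm hSHgen
    hm hXmeas hYmeas hXfin hXfund hYfund hαmeas hαdef hαint
  obtain ⟨D₁, D₂, hD₁, hD₂, hle'⟩ := exists_ncard_wlen_le hSHfin hSHsymm hSHgen hSGfin hSGsymm
    hSGgen hm hYmeas hXmeas hYfin hYfund hXfund hβmeas hβdef hβint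
  refine ⟨max C₁ D₁, max C₂ D₂, lt_max_of_lt_left hC₁, lt_max_of_lt_left hC₂, 1, fun n hn =>
    ⟨(hle n hn).trans ?_, (hle' n hn).trans ?_⟩⟩
  · gcongr
    · exact le_max_left _ _
    · exact finite_wlen_le_real hSHfin hSHsymm hSHgen _
    · exact le_max_left _ _
  · gcongr
    · exact le_max_right _ _
    · exact finite_wlen_le_real hSGfin hSGsymm hSGgen _
    · exact le_max_right _ _
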